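/- Let k be a field of characteristic zero and let A and B be commutative k-algebras that are integral domains such that A ⊗_k B is also an integral domain. If ML(A) is generated as a k-algebra by units of A and ML(B) is generated as a k-algebra by units of B, then ML(A ⊗_k B) = ML(A) ⊗_k ML(B) (as subalgebras of A ⊗_k B). -/

import Mathlib

/-- A derivation `D` is locally nilpotent if for every `a` some positive iterate of `D`
kills `a`. -/
def Derivation.IsLocallyNilpotent {k A : Type*} [CommRing k] [CommRing A] [Algebra k A]
    (D : Derivation k A A) : Prop :=
  ∀ a : A, ∃ n : ℕ, 0 < n ∧ (⇑D)^[n] a = 0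

/-- The kernel of a derivation `D : A → A`, as a `k`-subalgebra of `A`. -/
def Derivation.kerSubalgebra {k A : Type*} [CommRing k] [CommRing A] [Algebra k A]
    (D : Derivation k A A) : Subalgebra k A where
  carrier := {a : A | D a = 0}
  add_mem' := by
    intro a b ha hb
    simp only [Set.mem_setOf_eq] at *
    rw [map_add, ha, hb, add_zero]
  mul_mem' := by
    intro a b ha hb
    simp only [Set.mem_setOf_eq] at *
    rw [Derivation.leibniz, ha, hb, smul_zero, smul_zero, add_zero]
  algebraMap_mem' := fun r => by
    simp only [Set.mem_setOf_eq, Derivation.map_algebraMap]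

/-- The Makar-Limanov invariant of a commutative `k`-algebra `A`: the intersection of the
kernels of all locally nilpotent `k`-derivations of `A`. -/
def MakarLimanov (k A : Type*) [CommRing k] [CommRing A] [Algebra k A] : Subalgebra k A :=
  ⨅ D : {D : Derivation k A A // D.IsLocallyNilpotent}, (D : Derivation k A A).kerSubalgebra

open scoped TensorProduct

section Derivation

variable {k A B : Type*} [CommRing k] [CommRing A] [Algebra k A] [CommRing B] [Algebra k B]

/-- The general Leibniz rule for iterates of a derivation. -/
theorem Derivation.iterate_apply_mul (D : Derivation k A A) (n : ℕ) (a b : A) :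
    (⇑D)^[n] (a * b) =
      ∑ ij ∈ Finset.HasAntidiagonal.antidiagonal n, n.choose ij.1 • ((⇑D)^[ij.1] a * (⇑D)^[ij.2] b) := by
  induction n with
  | zero => simp
  | succ n ih =>
    rw [Finset.sum_antidiagonal_choose_succ_nsmul (fun i j => (⇑D)^[i] a * (⇑D)^[j] b) n]
    simp only [Function.iterate_succ_apply', ih, map_sum, map_nsmul, D.leibniz, smul_eq_mul,
      smul_add, Finset.sum_add_distrib]
    congr 1
    refine Finset.sum_congr rfl fun ij hij => ?_
    rw [n.choose_symm_of_eq_add (Finset.HasAntidiagonal.mem_antidiagonal.1 hij).symm, mul_comm]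

theorem Derivation.iterate_eq_zero_of_le (D : Derivation k A A) {m n : ℕ} (hmn : m ≤ n) {a : A}
    (h : (⇑D)^[m] a = 0) : (⇑D)^[n] a = 0 := by
  obtain ⟨d, rfl⟩ := Nat.exists_eq_add_of_le' hmn
  rw [Function.iterate_add_apply, h, iterate_map_zero]

theorem Derivation.IsLocallyNilpotent.exists_iterate_ne_zero {D : Derivation k A A}
    (hD : D.IsLocallyNilpotent) {a : A} (ha : a ≠ 0) :
    ∃ n : ℕ, (⇑D)^[n] a ≠ 0 ∧ (⇑D)^[n + 1] a = 0 := by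
  classical
  have hex : ∃ n, (⇑D)^[n + 1] a = 0 := by
    obtain ⟨n, -, hn⟩ := hD a
    exact ⟨n, D.iterate_eq_zero_of_le n.le_succ hn⟩
  refine ⟨Nat.find hex, fun h => ?_, Nat.find_spec hex⟩
  rcases hn : Nat.find hex with _ | n
  · rw [hn] at h
    exact ha h
  · rw [hn] at h
    exact Nat.find_min hex (by omega) h

/-- A locally nilpotent derivation of a domain of characteristic zero kills all units. -/
theorem Derivation.IsLocallyNilpotent.apply_eq_zero_of_isUnit [IsDomain A] [CharZero A]
    {D : Derivation k A A} (hD : D.IsLocallyNilpotent) {u : A} (hu : IsUnit u) : D u = 0 := by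
  obtain ⟨v, huv⟩ := hu.exists_right_inv
  obtain ⟨m, hm, hm'⟩ := hD.exists_iterate_ne_zero hu.ne_zero
  obtain ⟨n, hn, hn'⟩ := hD.exists_iterate_ne_zero (right_ne_zero_of_mul_eq_one huv)
  have hlead : (⇑D)^[m + n] (u * v) = (m + n).choose m • ((⇑D)^[m] u * (⇑D)^[n] v) := by
    rw [D.iterate_apply_mul]
    refine Finset.sum_eq_single (m, n) (fun ij hij hne => ?_) (by simp)
    rw [Finset.HasAntidiagonal.mem_antidiagonal] at hij
    rcases lt_trichotomy ij.1 m with h | h | h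
    · rw [D.iterate_eq_zero_of_le (by omega : n + 1 ≤ ij.2) hn', mul_zero, smul_zero]
    · exact absurd (Prod.ext h (by dsimp only; omega)) hne
    · rw [D.iterate_eq_zero_of_le (by omega : m + 1 ≤ ij.1) hm', zero_mul, smul_zero]
  have hpos : (m + n).choose m ≠ 0 := (Nat.choose_pos (Nat.le_add_right m n)).ne'
  obtain rfl : m = 0 := by
    by_contra h
    rw [huv, D.iterate_eq_zero_of_le (by omega : 1 ≤ m + n) (by simp)] at hlead
    exact smul_ne_zero hpos (mul_ne_zero hm hn) hlead.symm
  simpa using hm'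

theorem mem_makarLimanov_iff {a : A} :
    a ∈ MakarLimanov k A ↔ ∀ D : Derivation k A A, D.IsLocallyNilpotent → D a = 0 := by
  simp only [MakarLimanov, Algebra.mem_iInf, Subtype.forall]
  rfl

theorem IsUnit.mem_makarLimanov [IsDomain A] [CharZero A] {u : A} (hu : IsUnit u) :
    u ∈ MakarLimanov k A :=
  mem_makarLimanov_iff.2 fun _ hD => hD.apply_eq_zero_of_isUnit hu

/-- The image under an algebra map to a domain of characteristic zero of a Makar-Limanov
invariant generated by units lies in the Makar-Limanov invariant of the target. -/
theorem MakarLimanov.map_le_of_adjoin_units [IsDomain B] [CharZero B] (f : A →ₐ[k] B) {S : Set A}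
    (hS : ∀ a ∈ S, IsUnit a) (hadj : Algebra.adjoin k S = MakarLimanov k A) :
    (MakarLimanov k A).map f ≤ MakarLimanov k B := by
  rw [← hadj, AlgHom.map_adjoin, Algebra.adjoin_le_iff]
  rintro _ ⟨a, ha, rfl⟩
  exact ((hS a ha).map f).mem_makarLimanov

variable (B) in
/-- The derivation `D ⊗ 1` of `A ⊗ B` induced by a derivation `D` of `A`. -/
noncomputable def Derivation.rTensor (D : Derivation k A A) :
    Derivation k (A ⊗[k] B) (A ⊗[k] B) :=
  Derivation.mk' ((D : A →ₗ[k] A).rTensor B) fun x y => by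
    induction x with
    | zero => simp
    | add x₁ x₂ h₁ h₂ => rw [add_mul, map_add, h₁, h₂, map_add, add_smul, smul_add]; abel
    | tmul a b =>
      induction y with
      | zero => simp
      | add y₁ y₂ h₁ h₂ => rw [mul_add, map_add, h₁, h₂, map_add, add_smul, smul_add]; abel
      | tmul c d =>
        simp [TensorProduct.add_tmul, mul_comm d b]

variable (A) in
/-- The derivation `1 ⊗ D` of `A ⊗ B` induced by a derivation `D` of `B`. -/
noncomputable def Derivation.lTensor (D : Derivation k B B) :
    Derivation k (A ⊗[k] B) (A ⊗[k] B) :=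
  Derivation.mk' ((D : B →ₗ[k] B).lTensor A) fun x y => by
    induction x with
    | zero => simp
    | add x₁ x₂ h₁ h₂ => rw [add_mul, map_add, h₁, h₂, map_add, add_smul, smul_add]; abel
    | tmul a b =>
      induction y with
      | zero => simp
      | add y₁ y₂ h₁ h₂ => rw [mul_add, map_add, h₁, h₂, map_add, add_smul, smul_add]; abel
      | tmul c d =>
        simp [TensorProduct.tmul_add, mul_comm c a]

/-- A derivation of `A ⊗ B` is locally nilpotent if it is nilpotent on pure tensors. -/
theorem Derivation.isLocallyNilpotent_of_tmul {D : Derivation k (A ⊗[k] B) (A ⊗[k] B)}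
    (h : ∀ a b, ∃ n : ℕ, (⇑D)^[n] (a ⊗ₜ b) = 0) : D.IsLocallyNilpotent := by
  suffices ∀ x, ∃ n : ℕ, (⇑D)^[n] x = 0 from fun x =>
    let ⟨n, hn⟩ := this x
    ⟨n + 1, n.succ_pos, D.iterate_eq_zero_of_le n.le_succ hn⟩
  intro x
  induction x with
  | zero => exact ⟨0, rfl⟩
  | tmul a b => exact h a b
  | add x y hx hy =>
    obtain ⟨m, hm⟩ := hx
    obtain ⟨n, hn⟩ := hy
    exact ⟨max m n, by rw [iterate_map_add, D.iterate_eq_zero_of_le (le_max_left m n) hm,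
      D.iterate_eq_zero_of_le (le_max_right m n) hn, add_zero]⟩

theorem Derivation.iterate_rTensor_tmul (D : Derivation k A A) (n : ℕ) (a : A) (b : B) :
    (⇑(D.rTensor B))^[n] (a ⊗ₜ b) = (⇑D)^[n] a ⊗ₜ b := by
  induction n with
  | zero => rfl
  | succ n ih => rw [Function.iterate_succ_apply', ih, Function.iterate_succ_apply']; rfl

theorem Derivation.iterate_lTensor_tmul (D : Derivation k B B) (n : ℕ) (a : A) (b : B) :
    (⇑(D.lTensor A))^[n] (a ⊗ₜ b) = a ⊗ₜ (⇑D)^[n] b := by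
  induction n with
  | zero => rfl
  | succ n ih => rw [Function.iterate_succ_apply', ih, Function.iterate_succ_apply']; rfl

theorem Derivation.IsLocallyNilpotent.rTensor {D : Derivation k A A} (hD : D.IsLocallyNilpotent) :
    (D.rTensor B).IsLocallyNilpotent :=
  isLocallyNilpotent_of_tmul fun a b =>
    let ⟨n, _, hn⟩ := hD a
    ⟨n, by rw [iterate_rTensor_tmul, hn, TensorProduct.zero_tmul]⟩

theorem Derivation.IsLocallyNilpotent.lTensor {D : Derivation k B B} (hD : D.IsLocallyNilpotent) :
    (D.lTensor A).IsLocallyNilpotent :=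
  isLocallyNilpotent_of_tmul fun a b =>
    let ⟨n, _, hn⟩ := hD b
    ⟨n, by rw [iterate_lTensor_tmul, hn, TensorProduct.tmul_zero]⟩

end Derivation

section Kernels

variable {k M N : Type*} [Field k] [AddCommGroup M] [Module k M] [AddCommGroup N] [Module k N]

/-- If `y` is killed by all `1 ⊗ g` with `g ∈ G`, then `y` lies in `M ⊗ Q` for any
submodule `Q` containing the common kernel of `G`. -/
theorem TensorProduct.mem_range_lTensor_of_forall_eq_zero {G : Set (N →ₗ[k] N)}
    {Q : Submodule k N} (hQ : ∀ n, (∀ g ∈ G, g n = 0) → n ∈ Q) {y : M ⊗[k] N}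
    (hy : ∀ g ∈ G, g.lTensor M y = 0) : y ∈ LinearMap.range (Q.subtype.lTensor M) := by
  classical
  let ℬ := Module.Basis.ofVectorSpace k M
  have hcoeff (i) : equivFinsuppOfBasisLeft ℬ y i ∈ Q := by
    refine hQ _ fun g hg => ?_
    have hcomm : g ∘ₗ (TensorProduct.lid k N).toLinearMap ∘ₗ (ℬ.coord i).rTensor N =
        (TensorProduct.lid k N).toLinearMap ∘ₗ (ℬ.coord i).rTensor N ∘ₗ g.lTensor M := by
      ext m n
      simp
    rw [equivFinsuppOfBasisLeft_apply]
    simpa only [LinearMap.comp_apply, LinearEquiv.coe_coe, hy g hg, map_zero] using LinearMap.congr_fun hcomm y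
  rw [← (equivFinsuppOfBasisLeft ℬ).symm_apply_apply y, equivFinsuppOfBasisLeft_symm_apply]
  exact Submodule.sum_mem _ fun i _ => ⟨ℬ i ⊗ₜ ⟨_, hcoeff i⟩, rfl⟩

theorem TensorProduct.mem_range_rTensor_of_forall_eq_zero {F : Set (M →ₗ[k] M)}
    {P : Submodule k M} (hP : ∀ m, (∀ f ∈ F, f m = 0) → m ∈ P) {y : M ⊗[k] N}
    (hy : ∀ f ∈ F, f.rTensor N y = 0) : y ∈ LinearMap.range (P.subtype.rTensor N) := by
  obtain ⟨z, hz⟩ := mem_range_lTensor_of_forall_eq_zero (y := TensorProduct.comm k M N y) hP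
    fun f hf => by rw [LinearMap.lTensor_comm, hy f hf, map_zero]
  refine ⟨TensorProduct.comm k N P z, (TensorProduct.comm k M N).injective ?_⟩
  rw [← hz, ← LinearMap.lTensor_comm, ← TensorProduct.comm_symm, LinearEquiv.symm_apply_apply]

/-- If `x` is killed by all `f ⊗ 1` with `f ∈ F` and all `1 ⊗ g` with `g ∈ G`, then `x` lies in
`P ⊗ Q` whenever `P` and `Q` contain the common kernels of `F` and `G`. -/
theorem TensorProduct.mem_range_mapIncl_of_forall_eq_zero {F : Set (M →ₗ[k] M)}
    {G : Set (N →ₗ[k] N)} {P : Submodule k M} {Q : Submodule k N}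
    (hP : ∀ m, (∀ f ∈ F, f m = 0) → m ∈ P) (hQ : ∀ n, (∀ g ∈ G, g n = 0) → n ∈ Q)
    {x : M ⊗[k] N} (hF : ∀ f ∈ F, f.rTensor N x = 0) (hG : ∀ g ∈ G, g.lTensor M x = 0) :
    x ∈ LinearMap.range (TensorProduct.mapIncl P Q) := by
  obtain ⟨y, rfl⟩ := mem_range_rTensor_of_forall_eq_zero hP hF
  obtain ⟨z, rfl⟩ := mem_range_lTensor_of_forall_eq_zero (y := y) hQ fun g hg => by
    refine Module.Flat.rTensor_preserves_injective_linearMap (M := N) P.subtype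
      P.injective_subtype ?_
    rw [map_zero, ← hG g hg, ← LinearMap.comp_apply, ← LinearMap.comp_apply,
      LinearMap.rTensor_comp_lTensor, LinearMap.lTensor_comp_rTensor]
  exact ⟨z, by rw [← LinearMap.comp_apply, LinearMap.rTensor_comp_lTensor]⟩

end Kernels

/-- Over a field, the Makar-Limanov invariant of a tensor product is contained in the tensor
product of the Makar-Limanov invariants. -/
theorem MakarLimanov.tensorProduct_le (k A B : Type*) [Field k] [CommRing A] [Algebra k A]
    [CommRing B] [Algebra k B] :
    MakarLimanov k (A ⊗[k] B) ≤
      (MakarLimanov k A).map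
          (Algebra.TensorProduct.includeLeft : A →ₐ[k] A ⊗[k] B) ⊔
        (MakarLimanov k B).map
          (Algebra.TensorProduct.includeRight : B →ₐ[k] A ⊗[k] B) := by
  intro x hx
  rw [mem_makarLimanov_iff] at hx
  obtain ⟨z, rfl⟩ := TensorProduct.mem_range_mapIncl_of_forall_eq_zero (x := x)
    (F := {f | ∃ D : Derivation k A A, D.IsLocallyNilpotent ∧ (D : A →ₗ[k] A) = f})
    (G := {g | ∃ D : Derivation k B B, D.IsLocallyNilpotent ∧ (D : B →ₗ[k] B) = g})
    (P := Subalgebra.toSubmodule (MakarLimanov k A))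
    (Q := Subalgebra.toSubmodule (MakarLimanov k B))
    (fun a ha => mem_makarLimanov_iff.2 fun D hD => ha D ⟨D, hD, rfl⟩)
    (fun b hb => mem_makarLimanov_iff.2 fun D hD => hb D ⟨D, hD, rfl⟩)
    (by rintro _ ⟨D, hD, rfl⟩; exact hx _ hD.rTensor)
    (by rintro _ ⟨D, hD, rfl⟩; exact hx _ hD.lTensor)
  clear hx
  induction z with
  | zero => rw [map_zero]; exact zero_mem _
  | add y z hy hz => rw [map_add]; exact add_mem hy hz
  | tmul a b =>
    have hab : (a : A) ⊗ₜ[k] (b : B) = (a : A) ⊗ₜ[k] 1 * 1 ⊗ₜ[k] (b : B) := by simp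
    rw [TensorProduct.mapIncl, TensorProduct.map_tmul]
    refine (congrArg (· ∈ _) hab).mpr (mul_mem ?_ ?_)
    · exact le_sup_left (α := Subalgebra k (A ⊗[k] B)) ⟨a, a.2, rfl⟩
    · exact le_sup_right (α := Subalgebra k (A ⊗[k] B)) ⟨b, b.2, rfl⟩

open TensorProduct in
theorem makarLimanov_tensor_of_generated_by_units (k A B : Type*) [Field k] [CharZero k]
    [CommRing A] [IsDomain A] [Algebra k A] [CommRing B] [IsDomain B] [Algebra k B]
    [IsDomain (A ⊗[k] B)]
    (hA : ∃ S : Set A, (∀ a ∈ S, IsUnit a) ∧ Algebra.adjoin k S = MakarLimanov k A)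
    (hB : ∃ T : Set B, (∀ b ∈ T, IsUnit b) ∧ Algebra.adjoin k T = MakarLimanov k B) :
    MakarLimanov k (A ⊗[k] B) =
      (MakarLimanov k A).map
          (Algebra.TensorProduct.includeLeft : A →ₐ[k] A ⊗[k] B) ⊔
        (MakarLimanov k B).map
          (Algebra.TensorProduct.includeRight : B →ₐ[k] A ⊗[k] B) := by
  obtain ⟨S, hS, hSA⟩ := hA
  obtain ⟨T, hT, hTB⟩ := hB
  have : CharZero (A ⊗[k] B) :=
    charZero_of_injective_algebraMap (algebraMap k (A ⊗[k] B)).injective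
  exact le_antisymm (MakarLimanov.tensorProduct_le k A B)
    (sup_le (MakarLimanov.map_le_of_adjoin_units _ hS hSA)
      (MakarLimanov.map_le_of_adjoin_units _ hT hTB))
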